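/- For every rational number q such that 2q is not an integer (i.e., q ∈ ℚ \ ½ℤ), at least one of the sets {n ∈ ℕ : n ≥ 1 and Γ^(n)(q) is transcendental} and {n ∈ ℕ : n ≥ 1 and Γ^(n)(1−q) is transcendental} is infinite. -/

import Mathlib

open Polynomial in
theorem Polynomial.isIntegral_leadingCoeff_pow_mul_aeval {R A : Type*} [CommRing R] [CommRing A]
    [Algebra R A] {f : R[X]} {x : A} (hx : aeval x f = 0) (g : R[X]) {D : ℕ}
    (hg : g.natDegree ≤ D) :
    IsIntegral R (algebraMap R A (f.leadingCoeff ^ D) * aeval x g) := by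
  rw [aeval_eq_sum_range, Finset.mul_sum]
  refine IsIntegral.sum _ fun k hk ↦ ?_
  have hkD : k ≤ D := (Finset.mem_range_succ_iff.mp hk).trans hg
  have h : algebraMap R A (f.leadingCoeff ^ D) * g.coeff k • x ^ k =
      algebraMap R A (f.leadingCoeff ^ (D - k) * g.coeff k) * (f.leadingCoeff • x) ^ k := by
    rw [← Nat.sub_add_cancel hkD, pow_add, Nat.add_sub_cancel]
    simp only [Algebra.smul_def, map_mul, map_pow, mul_pow]
    ring
  rw [h]
  exact isIntegral_algebraMap.mul ((isIntegral_leadingCoeff_smul f x hx).pow k)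

/-- A multiset stable under the Galois group is the root multiset of an integer polynomial. -/
theorem exists_int_polynomial_aroots_eq {E : Type*} [Field E] [Algebra ℚ E] [FiniteDimensional ℚ E]
    [IsGalois ℚ E] (M : Multiset E) (hM : ∀ σ : E ≃ₐ[ℚ] E, M.map σ = M) :
    ∃ f : Polynomial ℤ, f ≠ 0 ∧ f.aroots E = M := by
  have hfix : (M.map fun a ↦ Polynomial.X - Polynomial.C a).prod ∈
      Polynomial.lifts (algebraMap ℚ E) := by
    rw [Polynomial.lifts_iff_coeff_lifts]
    intro n
    rw [IsGalois.mem_range_algebraMap_iff_fixed]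
    intro σ
    have h : ((M.map fun a ↦ Polynomial.X - Polynomial.C a).prod).map (σ : E →+* E) =
        (M.map fun a ↦ Polynomial.X - Polynomial.C a).prod := by
      conv_rhs => rw [← hM σ]
      rw [Polynomial.map_multiset_prod, Multiset.map_map, Multiset.map_map]
      simp
    conv_rhs => rw [← h, Polynomial.coeff_map]
    rfl
  obtain ⟨g, hg⟩ := (Polynomial.mem_lifts _).mp hfix
  obtain ⟨b, hb, hfb⟩ := IsLocalization.integerNormalization_spec (nonZeroDivisors ℤ) g
  have hb0 : (b : ℚ) ≠ 0 := by exact_mod_cast nonZeroDivisors.ne_zero hb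
  have hg0 : g ≠ 0 := by
    rintro rfl
    have : (M.map fun a ↦ Polynomial.X - Polynomial.C a).prod.Monic :=
      Polynomial.monic_multiset_prod_of_monic _ _ fun a _ ↦ Polynomial.monic_X_sub_C a
    exact this.ne_zero (by simpa using hg.symm)
  refine ⟨IsLocalization.integerNormalization (nonZeroDivisors ℤ) g, ?_, ?_⟩
  · rwa [Ne, IsLocalization.integerNormalization_eq_zero_iff le_rfl]
  · have hbE : algebraMap ℚ E b ≠ 0 := (map_ne_zero _).mpr hb0
    have : b • g = Polynomial.C (b : ℚ) * g := by
      rw [← Int.cast_smul_eq_zsmul ℚ, Polynomial.smul_eq_C_mul]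
    rw [Polynomial.aroots_def, IsScalarTower.algebraMap_eq ℤ ℚ E, ← Polynomial.map_map, hfb, this,
      Polynomial.map_mul, Polynomial.map_C, Polynomial.roots_C_mul _ hbE, hg,
      Polynomial.roots_multiset_prod_X_sub_C]

theorem Multiset.norm_sum_map_le {α F : Type*} [SeminormedAddCommGroup F] (M : Multiset α)
    (u : α → F) {B : ℝ} (h : ∀ a ∈ M, ‖u a‖ ≤ B) : ‖(M.map u).sum‖ ≤ M.card * B := by
  induction M using Multiset.induction_on with
  | empty => simp
  | cons a s ih =>
    have h1 := h a (Multiset.mem_cons_self a s)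
    have h2 := ih fun b hb ↦ h b (Multiset.mem_cons_of_mem hb)
    have h3 := norm_add_le (u a) (s.map u).sum
    simp only [Multiset.map_cons, Multiset.sum_cons, Multiset.card_cons]
    push_cast
    linarith

/-- A Galois-stable sum of integer polynomial values becomes an integer after clearing
denominators. -/
theorem exists_int_eq_leadingCoeff_pow_mul_sum_aeval {E : Type*} [Field E] [Algebra ℚ E]
    [FiniteDimensional ℚ E] [IsGalois ℚ E] (M : Multiset E) (hM : ∀ σ : E ≃ₐ[ℚ] E, M.map σ = M)
    {f : Polynomial ℤ} (hf : ∀ x ∈ M, Polynomial.aeval x f = 0) (g : Polynomial ℤ) {D : ℕ}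
    (hg : g.natDegree ≤ D) :
    ∃ z : ℤ, (f.leadingCoeff : E) ^ D * (M.map fun x ↦ Polynomial.aeval x g).sum = z := by
  have hint : IsIntegral ℤ
      ((f.leadingCoeff : E) ^ D * (M.map fun x ↦ Polynomial.aeval x g).sum) := by
    rw [← Multiset.sum_map_mul_left]
    refine IsIntegral.multiset_sum fun y hy ↦ ?_
    obtain ⟨x, hx, rfl⟩ := Multiset.mem_map.mp hy
    simpa using Polynomial.isIntegral_leadingCoeff_pow_mul_aeval (hf x hx) g hg
  have hfix : ((f.leadingCoeff : E) ^ D * (M.map fun x ↦ Polynomial.aeval x g).sum) ∈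
      Set.range (algebraMap ℚ E) := by
    rw [IsGalois.mem_range_algebraMap_iff_fixed]
    intro σ
    rw [map_mul, map_pow, map_intCast, map_multiset_sum, Multiset.map_map]
    conv_rhs => rw [← hM σ, Multiset.map_map]
    congr 3
    ext x
    exact (Polynomial.aeval_algHom_apply (σ.toAlgHom.restrictScalars ℤ) x g).symm
  obtain ⟨r, hr⟩ := hfix
  rw [← hr] at hint ⊢
  obtain ⟨z, hz⟩ := IsIntegrallyClosed.isIntegral_iff.mp
    ((isIntegral_algebraMap_iff (algebraMap ℚ E).injective).mp hint)
  exact ⟨z, by rw [← hz]; simp⟩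

/-- The nonzero exponents in a Galois-stable exponential sum cannot cancel a positive integer. -/
theorem natCast_add_sum_exp_ne_zero {E : Type*} [Field E] [Algebra ℚ E] [FiniteDimensional ℚ E]
    [IsGalois ℚ E] (i : E →ₐ[ℚ] ℂ) (M : Multiset E) (hM : ∀ σ : E ≃ₐ[ℚ] E, M.map σ = M)
    (h0 : (0 : E) ∉ M) {k : ℕ} (hk : k ≠ 0) :
    (k : ℂ) + (M.map fun x ↦ Complex.exp (i x)).sum ≠ 0 := by
  intro hsum
  obtain ⟨f, hf0, hfM⟩ := exists_int_polynomial_aroots_eq M hM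
  have : CharZero E := algebraRat.charZero E
  have hroot : ∀ x ∈ M, Polynomial.aeval x f = 0 := fun x hx ↦
    (Polynomial.mem_aroots.mp (hfM ▸ hx)).2
  have heval : f.eval 0 ≠ 0 := by
    intro h
    refine h0 (hfM ▸ Polynomial.mem_aroots.mpr ⟨hf0, ?_⟩)
    have := Polynomial.aeval_algebraMap_apply_eq_algebraMap_eval (A := E) (0 : ℤ) f
    simpa [h] using this
  obtain ⟨c, hc⟩ := LindemannWeierstrass.exp_polynomial_approx f heval
  have hlc : f.leadingCoeff ≠ 0 := Polynomial.leadingCoeff_ne_zero.mpr hf0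
  let C : ℝ := |(f.leadingCoeff : ℝ)| ^ f.natDegree * c
  have hlim : Filter.Tendsto (fun n : ℕ ↦ (M.card : ℝ) * C * (C ^ n / n.factorial))
      Filter.atTop (nhds 0) := by
    simpa using (FloorSemiring.tendsto_pow_div_factorial_atTop C).const_mul ((M.card : ℝ) * C)
  obtain ⟨N, hN⟩ := Filter.eventually_atTop.mp (hlim.eventually (gt_mem_nhds zero_lt_one))
  obtain ⟨p, hpge, hp⟩ := Nat.exists_infinite_primes
    (N + (Polynomial.eval 0 f).natAbs + f.leadingCoeff.natAbs + k + 1)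
  obtain ⟨n, hpn, g, hgdeg, hg⟩ := hc p (by omega) hp
  obtain ⟨z, hz⟩ := exists_int_eq_leadingCoeff_pow_mul_sum_aeval M hM hroot g
    (D := p * f.natDegree) (hgdeg.trans (Nat.sub_le _ _))
  set W : ℤ := f.leadingCoeff ^ (p * f.natDegree) * n * k + p * z with hW
  have hpW : ¬ (p : ℤ) ∣ W := by
    rw [hW, Int.dvd_add_left (dvd_mul_right _ _)]
    have hpp : Prime (p : ℤ) := Nat.prime_iff_prime_int.mp hp
    intro h
    rcases hpp.dvd_or_dvd h with h | h
    · rcases hpp.dvd_or_dvd h with h | h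
      · have := Int.natAbs_dvd_natAbs.mpr (hpp.dvd_of_dvd_pow h)
        have := Nat.le_of_dvd (Int.natAbs_pos.mpr hlc) this
        simp only [Int.natAbs_natCast] at this
        omega
      · exact hpn h
    · have := Nat.le_of_dvd (Nat.pos_of_ne_zero hk) (Int.natCast_dvd_natCast.mp h)
      omega
  have hW1 : (1 : ℝ) ≤ ‖(W : ℂ)‖ := by
    rw [Complex.norm_intCast]
    have : W ≠ 0 := fun h ↦ hpW (h ▸ dvd_zero _)
    exact_mod_cast Int.one_le_abs this
  have hzC : (f.leadingCoeff : ℂ) ^ (p * f.natDegree) *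
      (M.map fun x ↦ Polynomial.aeval (i x) g).sum = z := by
    have := congrArg i hz
    rw [map_mul, map_pow, map_intCast, map_intCast, map_multiset_sum, Multiset.map_map] at this
    rw [← this]
    congr 3
    ext x
    exact Polynomial.aeval_algHom_apply (i.restrictScalars ℤ) x g
  have hkey : (f.leadingCoeff : ℂ) ^ (p * f.natDegree) *
      (M.map fun x ↦ n • Complex.exp (i x) - p • Polynomial.aeval (i x) g).sum = -W := by
    rw [Multiset.sum_map_sub]
    simp only [zsmul_eq_mul, nsmul_eq_mul]
    rw [Multiset.sum_map_mul_left, Multiset.sum_map_mul_left, eq_neg_of_add_eq_zero_right hsum, hW]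
    push_cast
    rw [← hzC]
    ring
  have hbound : ‖(M.map fun x ↦ n • Complex.exp (i x) - p • Polynomial.aeval (i x) g).sum‖ ≤
      M.card * (c ^ p / (p - 1).factorial) := by
    refine Multiset.norm_sum_map_le M _ fun x hx ↦ hg (Polynomial.mem_aroots.mpr ⟨hf0, ?_⟩)
    have := Polynomial.aeval_algHom_apply (i.restrictScalars ℤ) x f
    rw [hroot x hx, map_zero] at this
    exact this
  have hsmall := hN (p - 1) (by omega)
  have hWeq : ‖(W : ℂ)‖ ≤ (M.card : ℝ) * C * (C ^ (p - 1) / (p - 1).factorial) := by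
    rw [← norm_neg, ← hkey, norm_mul, norm_pow, Complex.norm_intCast]
    refine (mul_le_mul_of_nonneg_left hbound (by positivity)).trans_eq ?_
    have hpC : C ^ p = C * C ^ (p - 1) := by
      rw [← pow_succ', Nat.sub_add_cancel hp.one_le]
    have hCp : C ^ p = |(f.leadingCoeff : ℝ)| ^ (p * f.natDegree) * c ^ p := by
      rw [mul_pow, ← pow_mul, mul_comm p]
    rw [mul_assoc (M.card : ℝ), ← mul_div_assoc C, ← hpC, hCp]
    ring
  linarith

theorem Multiset.powerset_map {α β : Type*} (f : α → β) (s : Multiset α) :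
    (s.map f).powerset = s.powerset.map (Multiset.map f) := by
  induction s using Multiset.induction_on with
  | empty => simp
  | cons a s ih => simp [ih, Multiset.powerset_cons, Multiset.map_map]

theorem Multiset.prod_map_one_add {α R : Type*} [CommSemiring R] (f : α → R) (s : Multiset α) :
    (s.map fun x ↦ 1 + f x).prod = (s.powerset.map fun t ↦ (t.map f).prod).sum := by
  induction s using Multiset.induction_on with
  | empty => simp
  | cons a s ih =>
    simp [ih, Multiset.powerset_cons, Multiset.map_map, add_mul, Multiset.sum_map_mul_left]

theorem prod_one_add_exp_ne_zero {E : Type*} [Field E] [Algebra ℚ E] [FiniteDimensional ℚ E]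
    [IsGalois ℚ E] (i : E →ₐ[ℚ] ℂ) (s : Multiset E) (hs : ∀ σ : E ≃ₐ[ℚ] E, s.map σ = s) :
    (s.map fun y ↦ 1 + Complex.exp (i y)).prod ≠ 0 := by
  classical
  intro hprod
  let T : Multiset E := s.powerset.map Multiset.sum
  have hT : ∀ σ : E ≃ₐ[ℚ] E, T.map σ = T := fun σ ↦ by
    change (s.powerset.map Multiset.sum).map σ = s.powerset.map Multiset.sum
    conv_rhs => rw [← hs σ, Multiset.powerset_map, Multiset.map_map]
    rw [Multiset.map_map]
    refine Multiset.map_congr rfl fun t _ ↦ ?_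
    simp [map_multiset_sum]
  have hTsum : (T.map fun y ↦ Complex.exp (i y)).sum = 0 := by
    rw [Multiset.prod_map_one_add] at hprod
    rw [← hprod, Multiset.map_map]
    refine congrArg _ (Multiset.map_congr rfl fun t _ ↦ ?_)
    simp [map_multiset_sum, Complex.exp_multiset_sum, Multiset.map_map]
  have hzero : ((T.filter (· = 0)).map fun y ↦ Complex.exp (i y)).sum =
      ((T.filter (· = 0)).card : ℂ) := by
    rw [Multiset.map_congr rfl (g := fun _ ↦ 1) fun y hy ↦ by
      simp [(Multiset.mem_filter.mp hy).2]]
    simp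
  rw [← Multiset.filter_add_not (· = 0) T, Multiset.map_add, Multiset.sum_add, hzero] at hTsum
  refine natCast_add_sum_exp_ne_zero i (T.filter (¬ · = 0)) (fun σ ↦ ?_) (by simp) ?_ hTsum
  · conv_rhs => rw [← hT σ, Multiset.filter_map]
    congr 1
    refine Multiset.filter_congr fun y _ ↦ ?_
    simp
  · have h0 : (0 : E) ∈ T.filter (· = 0) := Multiset.mem_filter.mpr
      ⟨Multiset.mem_map.mpr ⟨0, Multiset.zero_mem_powerset s, rfl⟩, rfl⟩
    exact (Multiset.card_pos_iff_exists_mem.mpr ⟨0, h0⟩).ne'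

theorem exp_ne_neg_one_of_isSplittingField {E : Type*} [Field E] [Algebra ℚ E] {P : Polynomial ℚ}
    [P.IsSplittingField ℚ E] (hP : Irreducible P) {α : ℂ} (hα : Polynomial.aeval α P = 0) :
    Complex.exp α ≠ -1 := by
  intro hexp
  have : FiniteDimensional ℚ E := Polynomial.IsSplittingField.finiteDimensional E P
  have : IsGalois ℚ E := IsGalois.of_separable_splitting_field hP.separable
  have i : E →ₐ[ℚ] ℂ := IsAlgClosed.lift
  have hsplit := Polynomial.IsSplittingField.splits E P
  refine prod_one_add_exp_ne_zero i (P.aroots E) (fun σ ↦ ?_) (Multiset.prod_eq_zero ?_)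
  · have h := hsplit.roots_map (σ.toAlgHom : E →+* E)
    rw [Polynomial.map_map, σ.toAlgHom.comp_algebraMap] at h
    exact h.symm
  · have h := hsplit.roots_map (i : E →+* ℂ)
    rw [Polynomial.map_map, i.comp_algebraMap] at h
    have hmem : α ∈ P.aroots ℂ := Polynomial.mem_aroots.mpr ⟨hP.ne_zero, hα⟩
    rw [Polynomial.aroots_def, h] at hmem
    obtain ⟨x, hxs, rfl⟩ := Multiset.mem_map.mp hmem
    exact Multiset.mem_map.mpr ⟨x, hxs, by rw [show i x = (i : E →+* ℂ) x from rfl, hexp]; simp⟩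

/-- **Lindemann theorem**: `π` is transcendental. -/
theorem transcendental_pi : Transcendental ℚ Real.pi := by
  intro hpi
  have hα : IsAlgebraic ℚ ((Real.pi : ℂ) * Complex.I) := by
    refine IsAlgebraic.mul (hpi.algebraMap (A := ℂ)) ⟨Polynomial.X ^ 2 + 1, ?_, by simp⟩
    exact (Polynomial.monic_X_pow_add_C (1 : ℚ) two_ne_zero).ne_zero
  let P := minpoly ℚ ((Real.pi : ℂ) * Complex.I)
  exact @exp_ne_neg_one_of_isSplittingField P.SplittingField _ _ P
    (Polynomial.IsSplittingField.splittingField P) (minpoly.irreducible hα.isIntegral) _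
    (minpoly.aeval _ _) Complex.exp_pi_mul_I
/-- The polynomials `R m` such that the `2m`-th derivative of the cosecant is
`R m (cot ^ 2)` times the cosecant. -/
noncomputable def cscDerivPoly : ℕ → Polynomial ℕ
  | 0 => 1
  | m + 1 => Polynomial.X * cscDerivPoly m +
      2 * Polynomial.X * (1 + Polynomial.X) * (cscDerivPoly m).derivative +
      (1 + Polynomial.X) * (cscDerivPoly m + 6 * Polynomial.X * (cscDerivPoly m).derivative +
        (1 + Polynomial.X) * (2 * (cscDerivPoly m).derivative +
          4 * Polynomial.X * (cscDerivPoly m).derivative.derivative))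

theorem Polynomial.aeval_nat_nonneg {R : Type*} [CommSemiring R] [PartialOrder R]
    [IsOrderedRing R] (P : Polynomial ℕ) {v : R} (hv : 0 ≤ v) :
    0 ≤ Polynomial.aeval v P := by
  rw [Polynomial.aeval_eq_sum_range]
  exact Finset.sum_nonneg fun k _ ↦ nsmul_nonneg (pow_nonneg hv k) _

theorem aeval_cscDerivPoly_pos (m : ℕ) {v : ℝ} (hv : 0 ≤ v) :
    0 < Polynomial.aeval v (cscDerivPoly m) := by
  induction m with
  | zero => simp [cscDerivPoly]
  | succ m ih =>
    have h1 := Polynomial.aeval_nat_nonneg (cscDerivPoly m).derivative hv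
    have h2 := Polynomial.aeval_nat_nonneg (cscDerivPoly m).derivative.derivative hv
    simp only [cscDerivPoly, map_add, map_mul, Polynomial.aeval_X, map_one, map_ofNat]
    positivity

theorem Polynomial.hasDerivAt_aeval_nat (P : Polynomial ℕ) (v : ℝ) :
    HasDerivAt (fun x : ℝ ↦ Polynomial.aeval x P) (Polynomial.aeval v P.derivative) v := by
  have h := (P.map (Nat.castRingHom ℝ)).hasDerivAt v
  have e : ∀ (Q : Polynomial ℕ) (x : ℝ),
      (Q.map (Nat.castRingHom ℝ)).eval x = Polynomial.aeval x Q := fun Q x ↦ by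
    rw [Polynomial.eval_map, Polynomial.aeval_def]; rfl
  rw [Polynomial.derivative_map, e] at h
  simpa only [e] using h

theorem hasDerivAt_csc {c y : ℝ} (hy : Real.sin (c * y) ≠ 0) :
    HasDerivAt (fun x ↦ 1 / Real.sin (c * x))
      (-(c * (1 / Real.sin (c * y)) * Real.cot (c * y))) y := by
  have h := (((hasDerivAt_id y).const_mul c).sin).inv hy
  simp only [one_div]
  refine h.congr_deriv ?_
  rw [Real.cot_eq_cos_div_sin]
  simp only [id]
  field_simp

theorem hasDerivAt_cot {c y : ℝ} (hy : Real.sin (c * y) ≠ 0) :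
    HasDerivAt (fun x ↦ Real.cot (c * x)) (-(c * (1 + Real.cot (c * y) ^ 2))) y := by
  have h := (((hasDerivAt_id y).const_mul c).cos).div (((hasDerivAt_id y).const_mul c).sin) hy
  simp only [Real.cot_eq_cos_div_sin]
  refine h.congr_deriv ?_
  simp only [id]
  field_simp
  ring

theorem iteratedDeriv_two_mul_csc (c : ℝ) (m : ℕ) {y : ℝ} (hy : Real.sin (c * y) ≠ 0) :
    iteratedDeriv (2 * m) (fun x ↦ 1 / Real.sin (c * x)) y =
      c ^ (2 * m) * (1 / Real.sin (c * y) *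
        Polynomial.aeval (Real.cot (c * y) ^ 2) (cscDerivPoly m)) := by
  have hnear : ∀ {z : ℝ}, Real.sin (c * z) ≠ 0 → ∀ᶠ x in nhds z, Real.sin (c * x) ≠ 0 :=
    fun hz ↦ ContinuousAt.eventually_ne (by fun_prop) hz
  induction m generalizing y with
  | zero => simp [cscDerivPoly]
  | succ m ih =>
    have hpoly : ∀ (Q : Polynomial ℕ) {z : ℝ}, Real.sin (c * z) ≠ 0 →
        HasDerivAt (fun x ↦ Polynomial.aeval (Real.cot (c * x) ^ 2) Q)
          (Polynomial.aeval (Real.cot (c * z) ^ 2) Q.derivative *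
            (2 * Real.cot (c * z) * -(c * (1 + Real.cot (c * z) ^ 2)))) z := fun Q z hz ↦ by
      have h := (Q.hasDerivAt_aeval_nat (Real.cot (c * z) ^ 2)).comp z ((hasDerivAt_cot hz).pow 2)
      refine h.congr_deriv ?_
      simp
    have h1 : ∀ {z : ℝ}, Real.sin (c * z) ≠ 0 →
        iteratedDeriv (2 * m + 1) (fun x ↦ 1 / Real.sin (c * x)) z =
        c ^ (2 * m) * -(c * (1 / Real.sin (c * z) * (Real.cot (c * z) *
          (Polynomial.aeval (Real.cot (c * z) ^ 2) (cscDerivPoly m) +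
            2 * (1 + Real.cot (c * z) ^ 2) *
              Polynomial.aeval (Real.cot (c * z) ^ 2) (cscDerivPoly m).derivative)))) :=
      fun {z} hz ↦ by
      rw [iteratedDeriv_succ, Filter.EventuallyEq.deriv_eq ((hnear hz).mono fun x hx ↦ ih hx)]
      refine ((((hasDerivAt_csc hz).mul (hpoly _ hz)).const_mul (c ^ (2 * m))).congr_deriv
        ?_).deriv
      ring
    rw [show 2 * (m + 1) = 2 * m + 1 + 1 by ring, iteratedDeriv_succ,
      Filter.EventuallyEq.deriv_eq ((hnear hy).mono fun x hx ↦ h1 hx)]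
    have hcot := hasDerivAt_cot hy
    have h := (((hasDerivAt_csc hy).mul (hcot.mul ((hpoly (cscDerivPoly m) hy).add
      ((((hcot.pow 2).const_add 1).const_mul 2).mul
        (hpoly (cscDerivPoly m).derivative hy))))).const_mul c).neg.const_mul (c ^ (2 * m))
    refine (h.congr_deriv ?_).deriv
    simp only [cscDerivPoly, map_add, map_mul, Polynomial.aeval_X, map_one, map_ofNat,
      Pi.mul_apply, Pi.add_apply, Pi.pow_apply]
    push_cast
    ring

theorem contDiffAt_real_Gamma {s : ℝ} (hs : ∀ m : ℕ, s ≠ -m) (n : ℕ) :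
    ContDiffAt ℝ n Real.Gamma s := by
  have hC : ContDiffAt ℂ n Complex.Gamma s := by
    have h0 : (Complex.Gamma s)⁻¹ ≠ 0 := inv_ne_zero (Complex.Gamma_ne_zero fun m ↦ by
      exact_mod_cast hs m)
    have h := (Complex.differentiable_one_div_Gamma.contDiff (n := n)).contDiffAt (x := (s : ℂ))
    exact (h.inv (by simpa using h0)).congr_of_eventuallyEq (.of_forall fun x ↦ by simp)
  exact hC.real_of_complex

theorem iteratedDeriv_Gamma_mul_Gamma_one_sub {s : ℝ} (hs : Real.sin (Real.pi * s) ≠ 0) (n : ℕ) :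
    ∑ i ∈ Finset.range (n + 1), (n.choose i : ℝ) * iteratedDeriv i Real.Gamma s *
      ((-1) ^ (n - i) * iteratedDeriv (n - i) Real.Gamma (1 - s)) =
    Real.pi * iteratedDeriv n (fun x ↦ 1 / Real.sin (Real.pi * x)) s := by
  have h1 : ∀ m : ℕ, s ≠ -m := fun m h ↦ hs (by
    rw [h, mul_neg, Real.sin_neg, mul_comm, Real.sin_nat_mul_pi, neg_zero])
  have h2 : ∀ m : ℕ, 1 - s ≠ -m := fun m h ↦ hs (by
    rw [show s = ((m + 1 : ℕ) : ℝ) by push_cast; linarith, mul_comm, Real.sin_nat_mul_pi])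
  have hcomp : ContDiffAt ℝ n (fun x ↦ Real.Gamma (1 - x)) s :=
    (contDiffAt_real_Gamma h2 n).comp s (by fun_prop)
  have hmul := iteratedDeriv_fun_mul (contDiffAt_real_Gamma h1 n) hcomp
  simp only [iteratedDeriv_comp_const_sub, smul_eq_mul] at hmul
  rw [← hmul, ← iteratedDeriv_const_mul_field]
  congr 1
  ext x
  rw [Real.Gamma_mul_Gamma_one_sub, mul_one_div]

theorem Transcendental.linearIndependent_pow {K A : Type*} [CommRing K] [CommRing A] [Algebra K A]
    {x : A} (hx : Transcendental K x) : LinearIndependent K fun n : ℕ ↦ x ^ n := by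
  have h := (Polynomial.basisMonomials K).linearIndependent.map' (Polynomial.aeval x).toLinearMap
    (LinearMap.ker_eq_bot.mpr (transcendental_iff_injective.mp hx))
  have he : ⇑(Polynomial.aeval x).toLinearMap ∘ ⇑(Polynomial.basisMonomials K) =
      fun n : ℕ ↦ x ^ n := by
    ext n
    simp [Polynomial.coe_basisMonomials]
  rwa [he] at h

theorem Transcendental.exists_pow_notMem {K A : Type*} [Field K] [CommRing A] [Algebra K A] {x : A}
    (hx : Transcendental K x) (V : Submodule K A) [FiniteDimensional K V] {e : ℕ → ℕ}
    (he : Function.Injective e) : ∃ m, x ^ e m ∉ V := by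
  by_contra! h
  have hli : LinearIndependent K fun m ↦ (⟨x ^ e m, h m⟩ : V) :=
    LinearIndependent.of_comp V.subtype (hx.linearIndependent_pow.comp e he)
  exact not_finite_iff_infinite.mpr inferInstance hli.finite

/-- A convolution of two sequences that are eventually in `K` stays in a fixed
finite-dimensional `K`-space. -/
theorem exists_finiteDimensional_forall_mul_mem {F A : Type*} [Field F] [Field A] [Algebra F A]
    (K : IntermediateField F A) {a b : ℕ → A} {N : ℕ} (ha : ∀ n ≥ N, a n ∈ K)
    (hb : ∀ n ≥ N, b n ∈ K) :
    ∃ V : Submodule K A, FiniteDimensional K V ∧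
      ∀ i j, 2 * N ≤ i + j → a i * b j ∈ V := by
  let S : Set A := {1} ∪ (a '' Set.Iio N ∪ b '' Set.Iio N)
  have hS : S.Finite := (Set.finite_singleton _).union
    (((Set.finite_Iio N).image a).union ((Set.finite_Iio N).image b))
  have hmul : ∀ x ∈ K, ∀ y ∈ S, x * y ∈ Submodule.span K S := fun x hx y hy ↦
    Submodule.smul_mem _ (⟨x, hx⟩ : K) (Submodule.subset_span hy)
  refine ⟨Submodule.span K S, FiniteDimensional.span_of_finite K hS, fun i j hij ↦ ?_⟩
  rcases lt_or_ge i N with hi | hi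
  · rw [mul_comm]
    exact hmul _ (hb j (by omega)) _ (.inr (.inl ⟨i, hi, rfl⟩))
  · rcases lt_or_ge j N with hj | hj
    · exact hmul _ (ha i hi) _ (.inr (.inr ⟨j, hj, rfl⟩))
    · simpa using hmul _ (K.mul_mem (ha i hi) (hb j hj)) 1 (.inl rfl)

theorem exists_forall_ge_isAlgebraic {u : ℕ → ℝ}
    (h : ¬ {n : ℕ | 1 ≤ n ∧ Transcendental ℚ (u n)}.Infinite) :
    ∃ N, ∀ n ≥ N, IsAlgebraic ℚ (u n) := by
  obtain ⟨B, hB⟩ := (Set.not_infinite.mp h).bddAbove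
  refine ⟨B + 1, fun n hn ↦ ?_⟩
  by_contra hu
  have := hB (show n ∈ _ from ⟨by omega, hu⟩)
  omega

/-- For every rational `q` with `2q ∉ ℤ`, at least one of the sequences of derivatives
of the Gamma function at `q` and at `1 - q` contains infinitely many transcendental
elements. -/
theorem gamma_deriv_transcendental_infinitely_often_disjunctive
    (q : ℚ) (hq : ¬ ∃ k : ℤ, 2 * q = (k : ℚ)) :
    {n : ℕ | 1 ≤ n ∧ Transcendental ℚ (iteratedDeriv n Real.Gamma (q : ℝ))}.Infinite ∨
    {n : ℕ | 1 ≤ n ∧ Transcendental ℚ (iteratedDeriv n Real.Gamma (1 - (q : ℝ)))}.Infinite := by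
  by_contra! h
  obtain ⟨N₁, hN₁⟩ := exists_forall_ge_isAlgebraic (Set.not_infinite.mpr h.1)
  obtain ⟨N₂, hN₂⟩ := exists_forall_ge_isAlgebraic (Set.not_infinite.mpr h.2)
  have hsin : Real.sin (Real.pi * q) ≠ 0 := by
    rw [mul_comm, Ne, Real.sin_eq_zero_iff]
    rintro ⟨k, hk⟩
    have : (k : ℝ) = q := mul_right_cancel₀ Real.pi_ne_zero hk
    have hkq : (k : ℚ) = q := by exact_mod_cast this
    exact hq ⟨2 * k, by rw [← hkq]; push_cast; ring⟩
  let K := algebraicClosure ℚ ℝ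
  have hmem : ∀ {x : ℝ}, IsAlgebraic ℚ x → x ∈ K := mem_algebraicClosure_iff.mpr
  obtain ⟨V, hV, hmul⟩ := exists_finiteDimensional_forall_mul_mem K
    (a := fun n ↦ iteratedDeriv n Real.Gamma (q : ℝ))
    (b := fun n ↦ iteratedDeriv n Real.Gamma (1 - (q : ℝ))) (N := max N₁ N₂)
    (fun n hn ↦ hmem (hN₁ n (le_of_max_le_left hn)))
    (fun n hn ↦ hmem (hN₂ n (le_of_max_le_right hn)))
  have hsinK : Real.sin (Real.pi * q) ∈ K := hmem (by
    rw [mul_comm]; exact (Real.isAlgebraic_sin_rat_mul_pi q).extendScalars Int.cast_injective)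
  have hcosK : Real.cos (Real.pi * q) ∈ K := hmem (by
    rw [mul_comm]; exact (Real.isAlgebraic_cos_rat_mul_pi q).extendScalars Int.cast_injective)
  have : Algebra.IsAlgebraic ℚ K := algebraicClosure.isAlgebraic ℚ ℝ
  have hpi : Transcendental K Real.pi := transcendental_pi.extendScalars K
  obtain ⟨m, hm⟩ := hpi.exists_pow_notMem V (e := fun m ↦ 2 * (m + max N₁ N₂) + 1)
    fun _ _ h ↦ by simpa using h
  refine hm ?_
  set M := m + max N₁ N₂ with hM
  let s : ℝ := 1 / Real.sin (Real.pi * q) *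
    Polynomial.aeval (Real.cot (Real.pi * q) ^ 2) (cscDerivPoly M)
  have hs0 : s ≠ 0 := mul_ne_zero (one_div_ne_zero hsin)
    (aeval_cscDerivPoly_pos M (sq_nonneg _)).ne'
  have hsK : s ∈ K := by
    have hcotK : Real.cot (Real.pi * q) ^ 2 ∈ K := by
      rw [Real.cot_eq_cos_div_sin]
      exact pow_mem (div_mem hcosK hsinK) 2
    refine mul_mem (div_mem (one_mem K) hsinK) ?_
    rw [Polynomial.aeval_eq_sum_range]
    exact sum_mem fun k _ ↦ nsmul_mem (pow_mem hcotK k) _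
  have hsum : Real.pi ^ (2 * M + 1) * s ∈ V := by
    have h := iteratedDeriv_Gamma_mul_Gamma_one_sub hsin (2 * M)
    rw [iteratedDeriv_two_mul_csc _ _ hsin, ← mul_assoc, ← pow_succ'] at h
    rw [← h]
    refine V.sum_mem fun i hi ↦ ?_
    have hi' : i ≤ 2 * M := Finset.mem_range_succ_iff.mp hi
    have := V.smul_mem ((((2 * M).choose i : ℕ) : K) * (-1) ^ (2 * M - i))
      (hmul i (2 * M - i) (by omega))
    convert this using 1
    rw [Algebra.smul_def]
    simp only [map_mul, map_pow, map_neg, map_one, map_natCast]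
    ring
  have := V.smul_mem (⟨s, hsK⟩⁻¹ : K) hsum
  convert this using 1
  rw [Algebra.smul_def, map_inv₀]
  change _ = s⁻¹ * _
  field_simp
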